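/- Let (g, Φ = (D, θ), ⟨·,·⟩) be an indecomposable extrinsic symmetric triple with n = dim g₋⁻ ≥ 1, let h be its mean curvature vector and A_h the associated shape operator on g₋⁻. If A_h ∘ A_h ≠ 0, then g is semisimple (i.e., its Killing form B_g(x,y) = tr(ad x ∘ ad y) is nondegenerate). -/

import Mathlib

/-- The span of all brackets `⁅u, v⁆` with `u ∈ U`, `v ∈ V`. -/
def bracketSpan {L : Type} [LieRing L] [LieAlgebra ℝ L]
    (U V : Submodule ℝ L) : Submodule ℝ L :=
  Submodule.span ℝ {z | ∃ u ∈ U, ∃ v ∈ V, z = ⁅u, v⁆}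

/-- An extrinsic symmetric triple `(g, (D, θ), ⟨·,·⟩)`: a metric Lie algebra with an
invariant nondegenerate symmetric bilinear form, an isometric involutive automorphism `θ`,
and an antisymmetric derivation `D` with `D³ = -D`, `Dθ = -θD` and `g₊⁺ = [g₊⁻, g₊⁻]`. -/
structure ExtSymTriple (L : Type) [LieRing L] [LieAlgebra ℝ L] [Module.Finite ℝ L] where
  B : LinearMap.BilinForm ℝ L
  Bsymm : ∀ x y, B x y = B y x
  Binv : ∀ x y z, B ⁅x, y⁆ z = B x ⁅y, z⁆
  Bnondeg : B.Nondegenerate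
  theta : L →ₗ[ℝ] L
  thetaLie : ∀ x y, theta ⁅x, y⁆ = ⁅theta x, theta y⁆
  thetaInvol : ∀ x, theta (theta x) = x
  thetaIso : ∀ x y, B (theta x) (theta y) = B x y
  D : L →ₗ[ℝ] L
  Dder : ∀ x y, D ⁅x, y⁆ = ⁅D x, y⁆ + ⁅x, D y⁆
  Danti : ∀ x y, B (D x) y = - B x (D y)
  D3 : ∀ x, D (D (D x)) = - D x
  Dtheta : ∀ x, D (theta x) = - theta (D x)
  cartan : (LinearMap.ker (theta - LinearMap.id) ⊓ LinearMap.ker D) =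
    bracketSpan
      (LinearMap.ker (theta - LinearMap.id) ⊓ LinearMap.ker (D ∘ₗ D + LinearMap.id))
      (LinearMap.ker (theta - LinearMap.id) ⊓ LinearMap.ker (D ∘ₗ D + LinearMap.id))

namespace ExtSymTriple

variable {L : Type} [LieRing L] [LieAlgebra ℝ L] [Module.Finite ℝ L] (T : ExtSymTriple L)

/-- `g₊⁺ = g₊ ∩ g⁺`. -/
def gPlusUp : Submodule ℝ L :=
  LinearMap.ker (T.theta - LinearMap.id) ⊓ LinearMap.ker T.D

/-- `g₊⁻ = g₊ ∩ g⁻`. -/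
def gPlusDown : Submodule ℝ L :=
  LinearMap.ker (T.theta - LinearMap.id) ⊓ LinearMap.ker (T.D ∘ₗ T.D + LinearMap.id)

/-- `g₋⁺ = g₋ ∩ g⁺`. -/
def gMinusUp : Submodule ℝ L :=
  LinearMap.ker (T.theta + LinearMap.id) ⊓ LinearMap.ker T.D

/-- `g₋⁻ = g₋ ∩ g⁻`. -/
def gMinusDown : Submodule ℝ L :=
  LinearMap.ker (T.theta + LinearMap.id) ⊓ LinearMap.ker (T.D ∘ₗ T.D + LinearMap.id)

/-- Indecomposability: `g` is not the direct sum of two nonzero ideals that are orthogonal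
to each other and invariant under `θ` and `D`. -/
def Indecomposable : Prop :=
  ¬ ∃ I J : LieIdeal ℝ L, I ≠ ⊥ ∧ J ≠ ⊥ ∧
    (I : Submodule ℝ L) ⊓ (J : Submodule ℝ L) = ⊥ ∧
    (I : Submodule ℝ L) ⊔ (J : Submodule ℝ L) = ⊤ ∧
    (∀ x ∈ I, ∀ y ∈ J, T.B x y = 0) ∧
    (∀ x ∈ I, T.theta x ∈ I) ∧ (∀ x ∈ I, T.D x ∈ I) ∧
    (∀ x ∈ J, T.theta x ∈ J) ∧ (∀ x ∈ J, T.D x ∈ J)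

end ExtSymTriple

open LinearMap in
/-- Endomorphisms that are adjoint with respect to a nondegenerate bilinear form have the
same trace. -/
theorem LinearMap.BilinForm.Nondegenerate.trace_eq_of_adjoint {K V : Type*} [Field K]
    [AddCommGroup V] [Module K V] [FiniteDimensional K V] {B : LinearMap.BilinForm K V}
    (hB : B.Nondegenerate) {f g : Module.End K V} (hfg : ∀ x y, B (f x) y = B x (g y)) :
    trace K V f = trace K V g := by
  have key : (BilinForm.toDual B hB).conj f = Module.Dual.transpose (R := K) g := by
    ext φ y
    obtain ⟨x, rfl⟩ := (BilinForm.toDual B hB).surjective φ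
    simpa [LinearEquiv.conj_apply, BilinForm.toDual_def, Module.Dual.transpose_apply]
      using hfg x y
  rw [← trace_transpose' g, ← key, trace_conj']

namespace ExtSymTriple

open LieAlgebra LinearMap

variable {L : Type} [LieRing L] [LieAlgebra ℝ L] [Module.Finite ℝ L] (T : ExtSymTriple L)

theorem ext_of_form {x y : L} (hxy : ∀ z, T.B x z = T.B y z) : x = y := by
  rw [← sub_eq_zero]
  refine T.Bnondeg.1 _ fun z => ?_
  rw [map_sub, LinearMap.sub_apply, hxy, sub_self]

theorem D_mul_ad (x : L) : T.D * ad ℝ L x = ad ℝ L (T.D x) + ad ℝ L x * T.D := by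
  ext y
  simp [T.Dder]

theorem theta_mul_ad (x : L) : T.theta * ad ℝ L x = ad ℝ L (T.theta x) * T.theta := by
  ext y
  simp [T.thetaLie]

theorem theta_mul_theta : T.theta * T.theta = 1 := by
  ext y
  simp [T.thetaInvol]

theorem D_mul_theta : T.D * T.theta = -(T.theta * T.D) := by
  ext y
  simp [T.Dtheta]

theorem D_cube : T.D * (T.D * T.D) = -T.D := by
  ext y
  simp [T.D3]

theorem killingForm_D (x y : L) :
    killingForm ℝ L (T.D x) y = trace ℝ L (T.D * ad ℝ L ⁅x, y⁆) := by
  have h1 : ad ℝ L (T.D x) = T.D * ad ℝ L x - ad ℝ L x * T.D := by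
    rw [T.D_mul_ad, add_sub_cancel_right]
  have h2 : ad ℝ L ⁅x, y⁆ = ad ℝ L x * ad ℝ L y - ad ℝ L y * ad ℝ L x := by
    ext z
    simp
  rw [killingForm_apply_apply, ← Module.End.mul_eq_comp, h1, h2, sub_mul, mul_sub, map_sub,
    map_sub, mul_assoc, mul_assoc, LinearMap.trace_mul_comm ℝ (ad ℝ L x), mul_assoc]

theorem killingForm_D_anti (x y : L) :
    killingForm ℝ L (T.D x) y = -killingForm ℝ L x (T.D y) := by
  rw [LieModule.traceForm_comm ℝ L L x, killingForm_D, killingForm_D, ← lie_skew, map_neg,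
    mul_neg, map_neg]

theorem killingForm_theta (x y : L) :
    killingForm ℝ L (T.theta x) y = killingForm ℝ L x (T.theta y) := by
  simp only [killingForm_apply_apply, ← Module.End.mul_eq_comp]
  have hx : ad ℝ L (T.theta x) = T.theta * (ad ℝ L x * T.theta) := by
    rw [← mul_assoc, T.theta_mul_ad, mul_assoc, T.theta_mul_theta, mul_one]
  have hy : ad ℝ L (T.theta y) = T.theta * (ad ℝ L y * T.theta) := by
    rw [← mul_assoc, T.theta_mul_ad, mul_assoc, T.theta_mul_theta, mul_one]
  rw [hx, hy, mul_assoc, LinearMap.trace_mul_comm ℝ T.theta]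
  simp only [mul_assoc]

/-- The endomorphism representing the Killing form with respect to `⟨·,·⟩`. -/
noncomputable def killingEnd : Module.End ℝ L :=
  (BilinForm.toDual T.B T.Bnondeg).symm.toLinearMap ∘ₗ killingForm ℝ L

theorem form_killingEnd (x y : L) : T.B (T.killingEnd x) y = killingForm ℝ L x y :=
  BilinForm.apply_toDual_symm_apply (hB := T.Bnondeg) (killingForm ℝ L x) y

theorem form_killingEnd_right (x y : L) : T.B x (T.killingEnd y) = killingForm ℝ L x y := by
  rw [T.Bsymm, form_killingEnd, LieModule.traceForm_comm]

theorem form_lie_left (x y z : L) : T.B ⁅x, y⁆ z = -T.B y ⁅x, z⁆ := by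
  rw [← lie_skew, map_neg, LinearMap.neg_apply, T.Binv]

theorem killingEnd_lie (x y : L) : T.killingEnd ⁅x, y⁆ = ⁅x, T.killingEnd y⁆ := by
  refine T.ext_of_form fun z => ?_
  rw [form_lie_left, form_killingEnd, form_killingEnd, ← lie_skew, map_neg,
    LinearMap.neg_apply, LieModule.traceForm_apply_lie_apply]

theorem commute_killingEnd_ad (x : L) : Commute T.killingEnd (ad ℝ L x) := by
  ext y
  simp [T.killingEnd_lie]

theorem killingEnd_D (x : L) : T.killingEnd (T.D x) = T.D (T.killingEnd x) := by
  refine T.ext_of_form fun z => ?_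
  rw [T.Danti, form_killingEnd, form_killingEnd, killingForm_D_anti]

theorem killingEnd_theta (x : L) : T.killingEnd (T.theta x) = T.theta (T.killingEnd x) := by
  refine T.ext_of_form fun z => ?_
  rw [← T.thetaIso (T.theta (T.killingEnd x)), T.thetaInvol, form_killingEnd, form_killingEnd,
    killingForm_theta]

theorem killingEnd_sq_eq_zero (hQ : IsNilpotent T.killingEnd) (x : L) :
    T.killingEnd (T.killingEnd x) = 0 := by
  refine T.Bnondeg.2 _ fun z => ?_
  rw [form_killingEnd_right, LieModule.traceForm_comm, killingForm_apply_apply,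
    ← Module.End.mul_eq_comp]
  have hx : ad ℝ L (T.killingEnd x) = T.killingEnd * ad ℝ L x := by
    ext y
    rw [Module.End.mul_apply, ad_apply, ad_apply, ← lie_skew, ← killingEnd_lie, ← map_neg,
      lie_skew]
  rw [hx, mul_assoc]
  exact (isNilpotent_trace_of_isNilpotent (Commute.isNilpotent_mul_right
    ((T.commute_killingEnd_ad x).mul_right (T.commute_killingEnd_ad z)) hQ)).eq_zero

theorem form_killingEnd_pow (k : ℕ) (x y : L) :
    T.B ((T.killingEnd ^ k) x) y = T.B x ((T.killingEnd ^ k) y) := by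
  induction k generalizing x y with
  | zero => simp
  | succ k ih =>
    rw [pow_succ, Module.End.mul_apply, ih, form_killingEnd, ← form_killingEnd_right, ← pow_succ,
      pow_succ', Module.End.mul_apply]

theorem killingEnd_pow_lie (k : ℕ) (x y : L) :
    (T.killingEnd ^ k) ⁅x, y⁆ = ⁅x, (T.killingEnd ^ k) y⁆ :=
  LinearMap.congr_fun ((T.commute_killingEnd_ad x).pow_left k).eq y

theorem killingEnd_pow_D (k : ℕ) (x : L) :
    (T.killingEnd ^ k) (T.D x) = T.D ((T.killingEnd ^ k) x) :=
  have hD : Commute T.killingEnd T.D := LinearMap.ext T.killingEnd_D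
  LinearMap.congr_fun (hD.pow_left k).eq x

theorem killingEnd_pow_theta (k : ℕ) (x : L) :
    (T.killingEnd ^ k) (T.theta x) = T.theta ((T.killingEnd ^ k) x) :=
  have hθ : Commute T.killingEnd T.theta := LinearMap.ext T.killingEnd_theta
  LinearMap.congr_fun (hθ.pow_left k).eq x

/-- By Fitting's lemma, on an indecomposable triple the endomorphism representing the Killing
form is either injective or nilpotent. -/
theorem Indecomposable.killingEnd_injective_or_isNilpotent {T : ExtSymTriple L}
    (hT : T.Indecomposable) : Function.Injective T.killingEnd ∨ IsNilpotent T.killingEnd := by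
  obtain ⟨k, hk⟩ := Filter.eventually_atTop.mp
    T.killingEnd.eventually_isCompl_ker_pow_range_pow
  replace hk := hk (k + 1) k.le_succ
  by_contra! hcon
  let I : LieIdeal ℝ L :=
    { ker (T.killingEnd ^ (k + 1)) with
      lie_mem := by
        intro x m (hm : (T.killingEnd ^ (k + 1)) m = 0)
        change (T.killingEnd ^ (k + 1)) ⁅x, m⁆ = 0
        rw [killingEnd_pow_lie, hm, lie_zero] }
  let J : LieIdeal ℝ L :=
    { range (T.killingEnd ^ (k + 1)) with
      lie_mem := by
        rintro x _ ⟨m, rfl⟩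
        exact ⟨⁅x, m⁆, T.killingEnd_pow_lie _ _ _⟩ }
  refine hT ⟨I, J, fun hI => hcon.1 ?_, fun hJ => hcon.2 ⟨k + 1, ?_⟩, hk.inf_eq_bot, hk.sup_eq_top,
    ?_, ?_, ?_, ?_, ?_⟩
  · refine (injective_iff_map_eq_zero _).2 fun x hx => ?_
    have hxI : x ∈ I := by
      change (T.killingEnd ^ (k + 1)) x = 0
      rw [pow_succ, Module.End.mul_apply, hx, map_zero]
    rwa [hI, LieSubmodule.mem_bot] at hxI
  · ext x
    have hxJ : (T.killingEnd ^ (k + 1)) x ∈ J := ⟨x, rfl⟩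
    rwa [hJ, LieSubmodule.mem_bot] at hxJ
  · rintro x (hx : (T.killingEnd ^ (k + 1)) x = 0) _ ⟨y, rfl⟩
    rw [← form_killingEnd_pow, hx, map_zero, LinearMap.zero_apply]
  · intro x (hx : (T.killingEnd ^ (k + 1)) x = 0)
    change (T.killingEnd ^ (k + 1)) _ = 0
    rw [killingEnd_pow_theta, hx, map_zero]
  · intro x (hx : (T.killingEnd ^ (k + 1)) x = 0)
    change (T.killingEnd ^ (k + 1)) _ = 0
    rw [killingEnd_pow_D, hx, map_zero]
  · rintro _ ⟨x, rfl⟩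
    exact ⟨T.theta x, T.killingEnd_pow_theta _ _⟩
  · rintro _ ⟨x, rfl⟩
    exact ⟨T.D x, T.killingEnd_pow_D _ _⟩

theorem nondegenerate_killingForm_of_injective (hQ : Function.Injective T.killingEnd) :
    (killingForm ℝ L).Nondegenerate := by
  refine (LieModule.traceForm_isSymm ℝ L L).isRefl.nondegenerate_iff_separatingLeft.mpr
    fun x hx => hQ ?_
  rw [map_zero]
  exact T.Bnondeg.1 _ fun z => (T.form_killingEnd x z).trans (hx z)

theorem mem_gMinusDown {x : L} :
    x ∈ T.gMinusDown ↔ T.theta x = -x ∧ T.D (T.D x) = -x := by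
  simp [gMinusDown, add_eq_zero_iff_eq_neg]

/-- The orthogonal projection onto `g₋⁻`. -/
noncomputable def projMinusDown : Module.End ℝ L :=
  (2⁻¹ : ℝ) • (T.D * T.D * (T.theta - 1))

theorem projMinusDown_apply (x : L) :
    T.projMinusDown x = (2⁻¹ : ℝ) • (T.D (T.D (T.theta x)) - T.D (T.D x)) := by
  simp [projMinusDown]

theorem theta_D_D (x : L) : T.theta (T.D (T.D x)) = T.D (T.D (T.theta x)) := by
  rw [T.Dtheta, map_neg, T.Dtheta, neg_neg]

theorem projMinusDown_mem (x : L) : T.projMinusDown x ∈ T.gMinusDown := by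
  rw [mem_gMinusDown, projMinusDown_apply]
  constructor
  · simp only [map_smul, map_sub, theta_D_D, T.thetaInvol, ← smul_neg, neg_sub]
  · simp only [map_smul, map_sub, T.D3, ← smul_neg, neg_sub, neg_sub_neg]

theorem form_projMinusDown {u : L} (hu : u ∈ T.gMinusDown) (x : L) :
    T.B u (T.projMinusDown x) = T.B u x := by
  obtain ⟨hθ, hD⟩ := T.mem_gMinusDown.1 hu
  have hDD (z : L) : T.B u (T.D (T.D z)) = -T.B u z := by
    rw [← neg_neg (T.B u (T.D (T.D z))), ← T.Danti, ← T.Danti, hD, map_neg,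
      LinearMap.neg_apply]
  have hθx : T.B u (T.theta x) = -T.B u x := by
    rw [← T.thetaIso, hθ, T.thetaInvol, map_neg, LinearMap.neg_apply]
  rw [projMinusDown_apply, map_smul, map_sub, hDD, hDD, hθx, smul_eq_mul]
  ring

theorem trace_D_mul_theta_mul_ad (x : L) : trace ℝ L (T.D * T.theta * ad ℝ L x) = 0 := by
  have hadj : trace ℝ L (T.D * T.theta * ad ℝ L x) =
      trace ℝ L (ad ℝ L x * (T.theta * T.D)) := by
    refine T.Bnondeg.trace_eq_of_adjoint fun y z => ?_
    have hθ (u v : L) : T.B (T.theta u) v = T.B u (T.theta v) := by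
      rw [← T.thetaIso u, T.thetaInvol]
    simp only [Module.End.mul_apply, ad_apply]
    rw [T.Danti, hθ, form_lie_left, neg_neg]
  rw [← neg_neg (T.theta * T.D), ← T.D_mul_theta, mul_neg, map_neg,
    LinearMap.trace_mul_comm] at hadj
  rw [LinearMap.trace_mul_comm]
  linarith

theorem trace_D_mul_ad_mul_projMinusDown (x : L) :
    trace ℝ L (T.D * ad ℝ L x * T.projMinusDown) = 2⁻¹ * trace ℝ L (T.D * ad ℝ L x) := by
  have h1 : T.projMinusDown * T.D = (2⁻¹ : ℝ) • (T.D * T.theta + T.D) := by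
    have h2 : T.D * T.D * (T.theta * T.D) = T.D * T.theta := by
      rw [← neg_neg (T.theta * T.D), ← T.D_mul_theta, mul_neg, ← mul_assoc, mul_assoc T.D,
        T.D_cube, neg_mul, neg_neg]
    rw [projMinusDown, smul_mul_assoc, mul_assoc, sub_mul, one_mul, mul_sub, h2, mul_assoc,
      T.D_cube, sub_neg_eq_add]
  rw [LinearMap.trace_mul_comm, ← mul_assoc, h1, smul_mul_assoc, map_smul, add_mul, map_add,
    trace_D_mul_theta_mul_ad, zero_add, smul_eq_mul]

section Frame

variable {T} {n : ℕ} {e : Fin n → L} {κ : Fin n → ℝ}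

theorem projMinusDown_eq_sum
    (hmem : ∀ j, e j ∈ T.gMinusDown)
    (hspan : ∀ x ∈ T.gMinusDown, x ∈ Submodule.span ℝ (Set.range e))
    (horth : ∀ i j, i ≠ j → T.B (e i) (e j) = 0)
    (hκ : ∀ j, T.B (e j) (e j) = κ j) (hκ1 : ∀ j, κ j = 1 ∨ κ j = -1) :
    T.projMinusDown = ∑ j, (κ j • T.B (e j)).smulRight (e j) := by
  have hfix (w : L) (hw : w ∈ T.gMinusDown) : ∑ j, (κ j * T.B (e j) w) • e j = w := by
    obtain ⟨c, rfl⟩ := (Submodule.mem_span_range_iff_exists_fun ℝ).1 (hspan w hw)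
    refine Finset.sum_congr rfl fun j _ => ?_
    rw [map_sum, Finset.sum_eq_single j]
    · rw [map_smul, hκ, smul_eq_mul]
      congr 1
      rcases hκ1 j with hj | hj <;> rw [hj] <;> ring
    · intro i _ hij
      rw [map_smul, horth j i hij.symm, smul_zero]
    · simp
  ext x
  rw [← hfix _ (T.projMinusDown_mem x)]
  simp [T.form_projMinusDown (hmem _)]

/-- The mean curvature vector represents the functional `x ↦ tr (D ∘ ad x) / 2n`. -/
theorem form_sum_frame
    (hmem : ∀ j, e j ∈ T.gMinusDown)
    (hspan : ∀ x ∈ T.gMinusDown, x ∈ Submodule.span ℝ (Set.range e))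
    (horth : ∀ i j, i ≠ j → T.B (e i) (e j) = 0)
    (hκ : ∀ j, T.B (e j) (e j) = κ j) (hκ1 : ∀ j, κ j = 1 ∨ κ j = -1) (x : L) :
    T.B (∑ j, κ j • ⁅T.D (e j), e j⁆) x = 2⁻¹ * trace ℝ L (T.D * ad ℝ L x) := by
  rw [← trace_D_mul_ad_mul_projMinusDown,
    projMinusDown_eq_sum hmem hspan horth hκ hκ1, Finset.mul_sum, map_sum, map_sum,
    LinearMap.sum_apply]
  refine Finset.sum_congr rfl fun j _ => ?_
  have hcomp : T.D * ad ℝ L x * (κ j • T.B (e j)).smulRight (e j) =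
      (κ j • T.B (e j)).smulRight (T.D ⁅x, e j⁆) := by
    ext y
    simp
  rw [hcomp, trace_smulRight, map_smul, LinearMap.smul_apply, LinearMap.smul_apply, T.Binv,
    T.Danti, ← map_neg, ← map_neg, lie_skew]

theorem lie_sum_frame
    (hmem : ∀ j, e j ∈ T.gMinusDown)
    (hspan : ∀ x ∈ T.gMinusDown, x ∈ Submodule.span ℝ (Set.range e))
    (horth : ∀ i j, i ≠ j → T.B (e i) (e j) = 0)
    (hκ : ∀ j, T.B (e j) (e j) = κ j) (hκ1 : ∀ j, κ j = 1 ∨ κ j = -1) (x : L) :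
    ⁅∑ j, κ j • ⁅T.D (e j), e j⁆, x⁆ = (2⁻¹ : ℝ) • T.killingEnd (T.D x) := by
  refine T.ext_of_form fun z => ?_
  rw [T.Binv, form_sum_frame hmem hspan horth hκ hκ1, map_smul, LinearMap.smul_apply,
    form_killingEnd, killingForm_D, smul_eq_mul]

end Frame

end ExtSymTriple

/-- **Proposition 2.** For an indecomposable extrinsic symmetric triple with mean curvature
vector `h`: if `A_h ∘ A_h ≠ 0` (where `A_h u = -⁅Du, h⁆`, so `A_h (A_h u) = ⁅D ⁅Du, h⁆, h⁆`),
then `g` is semisimple, i.e. its Killing form is nondegenerate. -/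
theorem semisimple_of_shape_sq_ne_zero
    {L : Type} [LieRing L] [LieAlgebra ℝ L] [Module.Finite ℝ L]
    (T : ExtSymTriple L) (hindec : T.Indecomposable)
    (n : ℕ) (hn : 1 ≤ n) (hdim : n = Module.finrank ℝ T.gMinusDown)
    (e : Fin n → L) (hmem : ∀ j, e j ∈ T.gMinusDown)
    (hspan : ∀ x ∈ T.gMinusDown, x ∈ Submodule.span ℝ (Set.range e))
    (horth : ∀ i j, i ≠ j → T.B (e i) (e j) = 0)
    (κ : Fin n → ℝ) (hκ : ∀ j, T.B (e j) (e j) = κ j) (hκ1 : ∀ j, κ j = 1 ∨ κ j = -1)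
    (h : L) (hh : h = (n : ℝ)⁻¹ • ∑ j, κ j • ⁅T.D (e j), e j⁆)
    (hA2 : ∃ u ∈ T.gMinusDown, ⁅T.D ⁅T.D u, h⁆, h⁆ ≠ 0) :
    (killingForm ℝ L).Nondegenerate := by
  refine (hindec.killingEnd_injective_or_isNilpotent).elim
    T.nondegenerate_killingForm_of_injective fun hQ => ?_
  obtain ⟨u, -, hu⟩ := hA2
  have hlie (x : L) :
      ⁅x, h⁆ = T.killingEnd (-((n : ℝ)⁻¹ • (2⁻¹ : ℝ) • T.D x)) := by
    rw [← lie_skew, hh, smul_lie, ExtSymTriple.lie_sum_frame hmem hspan horth hκ hκ1, map_neg,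
      map_smul, map_smul]
  refine absurd ?_ hu
  rw [hlie, hlie, ← T.killingEnd_D, ← T.killingEnd_D, ← map_smul, ← map_smul, ← map_neg,
    T.killingEnd_sq_eq_zero hQ]
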